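/- There exists f ∈ P_8, i.e. an even trigonometric polynomial f(φ) = Σ_{k=0}^{8} a_k cos(kφ) of degree 8 with all a_k ≥ 0, a_1 > a_0 > 0, and f(φ) ≥ 0 for all real φ, such that (f(0) − a_0)/(√a_1 − √a_0)² < 34.53991919. Consequently V_8 < 34.53991919. -/

import Mathlib

/-- `P_n`: coefficient sequences of even trigonometric polynomials
`f(φ) = Σ_{k=0}^n a_k cos(kφ)` with nonnegative coefficients, `a_1 > a_0`,
which are nonnegative everywhere. -/
def LandauSet (n : ℕ) : Set (ℕ → ℝ) :=
  {a | (∀ k ≤ n, 0 ≤ a k) ∧ a 0 < a 1 ∧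
    ∀ φ : ℝ, 0 ≤ ∑ k ∈ Finset.range (n + 1), a k * Real.cos (k * φ)}

/-- The Landau ratio `(f(0) - a_0) / (√a_1 - √a_0)^2`. -/
noncomputable def landauRatio (n : ℕ) (a : ℕ → ℝ) : ℝ :=
  ((∑ k ∈ Finset.range (n + 1), a k) - a 0) /
    (Real.sqrt (a 1) - Real.sqrt (a 0)) ^ 2

/-- `V_n = inf_{f ∈ P_n} (f(0) - a_0)/(√a_1 - √a_0)^2`. -/
noncomputable def landauV (n : ℕ) : ℝ := sInf (landauRatio n '' LandauSet n)

/-- Fejér's positivity: `∑ i j, c i * c j * cos ((i - j) φ)` is the squared modulus of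
`∑ k, c k * exp (i k φ)`. -/
theorem sum_sum_mul_cos_sub_nonneg (s : Finset ℕ) (c : ℕ → ℝ) (φ : ℝ) :
    0 ≤ ∑ i ∈ s, ∑ j ∈ s, c i * c j * Real.cos (((i : ℝ) - j) * φ) := by
  have h : ∑ i ∈ s, ∑ j ∈ s, c i * c j * Real.cos (((i : ℝ) - j) * φ) =
      (∑ k ∈ s, c k * Real.cos (k * φ)) ^ 2 + (∑ k ∈ s, c k * Real.sin (k * φ)) ^ 2 := by
    simp only [sq, Finset.sum_mul_sum, ← Finset.sum_add_distrib]
    refine Finset.sum_congr rfl fun i _ => Finset.sum_congr rfl fun j _ => ?_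
    rw [sub_mul, Real.cos_sub]
    ring
  rw [h]
  positivity

theorem landauRatio_nonneg {n : ℕ} {a : ℕ → ℝ} (ha : a ∈ LandauSet n) :
    0 ≤ landauRatio n a := by
  refine div_nonneg (sub_nonneg.2 ?_) (sq_nonneg _)
  exact Finset.single_le_sum (f := a) (fun k hk => ha.1 k (by simpa [Nat.lt_succ_iff] using hk))
    (by simp)

theorem landauV_le_landauRatio {n : ℕ} {a : ℕ → ℝ} (ha : a ∈ LandauSet n) :
    landauV n ≤ landauRatio n a := by
  refine csInf_le ⟨0, ?_⟩ ⟨a, ha, rfl⟩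
  rintro _ ⟨b, hb, rfl⟩
  exact landauRatio_nonneg hb

/-- The coefficients of a polynomial whose squared modulus on the unit circle is nearly
extremal in degree `8`. -/
def fejerRieszFactor : ℕ → ℝ
  | 0 => 124630
  | 1 => 380526
  | 2 => 596842
  | 3 => 588836
  | 4 => 356268
  | 5 => 91267
  | 6 => -31534
  | 7 => -14689
  | 8 => 15950
  | _ => 0

/-- The cosine coefficients of the squared modulus of `fejerRieszFactor`. -/
def nearExtremal : ℕ → ℝ
  | 0 => 1000001996926
  | 1 => 1731261491172
  | 2 => 1103501367378
  | 3 => 482163960072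
  | 4 => 114686788500
  | 5 => 42776
  | 6 => 2132
  | 7 => 8477399260
  | 8 => 3975697000
  | _ => 0

theorem nearExtremal_mem : nearExtremal ∈ LandauSet 8 := by
  refine ⟨fun k hk => ?_, by norm_num [nearExtremal], fun φ => ?_⟩
  · interval_cases k <;> norm_num [nearExtremal]
  · refine (sum_sum_mul_cos_sub_nonneg (Finset.range 9) fejerRieszFactor φ).trans_eq ?_
    norm_num [Finset.sum_range_succ, fejerRieszFactor, nearExtremal, neg_mul, Real.cos_neg]
    ring

theorem landauRatio_nearExtremal_lt : landauRatio 8 nearExtremal < 34.53991919 := by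
  have h1 : (1315774.1 : ℝ) ≤ √1731261491172 := Real.le_sqrt_of_sq_le (by norm_num)
  have h0 : √1000001996926 ≤ (1000001 : ℝ) := Real.sqrt_le_iff.2 (by norm_num)
  have h : (315773.1 : ℝ) ≤ √1731261491172 - √1000001996926 := by linarith
  have hsq : (315773.1 : ℝ) ^ 2 ≤ (√1731261491172 - √1000001996926) ^ 2 := by gcongr
  simp only [landauRatio, Finset.sum_range_succ, Finset.sum_range_zero, nearExtremal]
  rw [div_lt_iff₀ (lt_of_lt_of_le (by norm_num) hsq)]
  refine lt_of_lt_of_le ?_ (mul_le_mul_of_nonneg_left hsq (by norm_num))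
  norm_num

/-- There is `f ∈ P_8` with `a_1 > a_0 > 0` whose Landau ratio is less than
`34.53991919`; consequently `V_8 < 34.53991919`. -/
theorem landau_V8 :
    (∃ a ∈ LandauSet 8, 0 < a 0 ∧ landauRatio 8 a < 34.53991919) ∧
      landauV 8 < 34.53991919 :=
  ⟨⟨nearExtremal, nearExtremal_mem, by norm_num [nearExtremal], landauRatio_nearExtremal_lt⟩,
    (landauV_le_landauRatio nearExtremal_mem).trans_lt landauRatio_nearExtremal_lt⟩
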